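/- Let (G, 𝒴, W) be a discrete memoryless channel with finite abelian input group G, and let H be a subgroup of G that is maximal for the channel. Then C_{H,G}, the supremum of rates achievable over this channel using shifted group codes of the form ℂ + v with ℂ a subgroup of H^n and v ∈ G^n, satisfies C_{H,G} ≤ C^U_{|H*|}, where H* is an optimal coset of H. -/

import Mathlib

open scoped BigOperators Classical

noncomputable section

/-- Mutual information (in bits) between a channel input with pmf `pIn` and the
corresponding output of the channel `W`. -/
def mutualInfo {G Y : Type*} [Fintype G] [Fintype Y] (W : G → Y → ℝ) (pIn : G → ℝ) : ℝ :=
  ∑ x : G, ∑ y : Y,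
    pIn x * W x y *
      Real.logb 2 ((pIn x * W x y) / (pIn x * ∑ x' : G, pIn x' * W x' y))

/-- `C^U_{|S|}` : mutual information between input and output when the input is
uniformly distributed on the subset `S`. -/
def CU {G Y : Type*} [Fintype G] [Fintype Y] (W : G → Y → ℝ) (S : Finset G) : ℝ :=
  mutualInfo W (fun x => if x ∈ S then (S.card : ℝ)⁻¹ else 0)

/-- The `n`-fold memoryless extension of the channel `W`. -/
def Wn {G Y : Type*} (W : G → Y → ℝ) {n : ℕ} (x : Fin n → G) (y : Fin n → Y) : ℝ :=
  ∏ N, W (x N) (y N)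

/-- Average probability of error of the encoder `e` and decoder `f` on the DMC `W`. -/
def avgErr {G Y : Type*} [Fintype Y] (W : G → Y → ℝ) {n M : ℕ}
    (e : Fin M → Fin n → G) (f : (Fin n → Y) → Fin M) : ℝ :=
  (M : ℝ)⁻¹ * ∑ m : Fin M, ∑ y : Fin n → Y, if f y ≠ m then Wn W (e m) y else 0

/-- `R` is achievable over the channel `W` using shifted group codes whose underlying
group code has all its codeword components lying in `H`. -/
def achievable {G Y : Type*} [AddCommGroup G] [Fintype Y]
    (W : G → Y → ℝ) (H : Set G) (R : ℝ) : Prop :=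
  0 ≤ R ∧ ∀ ε > 0, ∃ n₀ : ℕ, ∀ n ≥ n₀, ∃ M : ℕ, ∃ C : AddSubgroup (Fin n → G),
    ∃ v : Fin n → G, ∃ e : Fin M → Fin n → G, ∃ f : (Fin n → Y) → Fin M,
      (2 : ℝ) ^ ((n : ℝ) * (R - ε)) ≤ M ∧
      (∀ c ∈ C, ∀ N, c N ∈ H) ∧
      (∀ m, e m ∈ {x | ∃ c ∈ C, x = c + v}) ∧
      (∀ x ∈ {x : Fin n → G | ∃ c ∈ C, x = c + v},
        Nat.card {m : Fin M // e m = x} * Nat.card C = M) ∧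
      avgErr W e f ≤ ε

/-- capacity of shifted group codes whose components are constrained to `H`. -/
def capacity {G Y : Type*} [AddCommGroup G] [Fintype Y]
    (W : G → Y → ℝ) (H : Set G) : ℝ :=
  sSup {R : ℝ | achievable W H R}

/-- The subgroup `H_θ = ⊕ᵢ pᵢ^{θᵢ} ℤ_{pᵢ^{rᵢ}}` of `G = ⊕ᵢ ℤ_{pᵢ^{rᵢ}}`. -/
def Htheta {I : ℕ} (p : Fin I → ℕ) (r : Fin I → ℕ) (θ : Fin I → ℕ) :
    AddSubgroup (∀ i, ZMod (p i ^ r i)) where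
  carrier := {x | ∀ i, ∃ c, x i = (p i : ZMod (p i ^ r i)) ^ θ i * c}
  zero_mem' := fun i => ⟨0, by simp⟩
  add_mem' := by
    intro a b ha hb i
    obtain ⟨c, hc⟩ := ha i
    obtain ⟨d, hd⟩ := hb i
    exact ⟨c + d, by simp [hc, hd, mul_add]⟩
  neg_mem' := by
    intro a ha i
    obtain ⟨c, hc⟩ := ha i
    exact ⟨-c, by simp [hc]⟩

/-- The cosets of a subgroup `H` of a finite abelian group, as a finite family of finite sets. -/
def cosetsOf {G : Type*} [AddCommGroup G] [Fintype G] (H : AddSubgroup G) :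
    Finset (Finset G) :=
  Finset.univ.image (fun g : G => Finset.univ.filter (fun x => x - g ∈ H))

/-- A subgroup, as a finite subset of the ambient finite group. -/
def subFinset {G : Type*} [AddCommGroup G] [Fintype G] (H : AddSubgroup G) : Finset G :=
  Finset.univ.filter (· ∈ H)

/-- `C^U_{|K*|}` : the value of `C^U` at an optimal coset `K*` of the subgroup `K`,
i.e. the maximum of `C^U_{|S|}` over all cosets `S` of `K` in `G`. -/
def maxCosetCU {G Y : Type*} [AddCommGroup G] [Fintype G] [Fintype Y]
    (W : G → Y → ℝ) (K : AddSubgroup G) : ℝ :=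
  sSup {x : ℝ | ∃ g : G, x = CU W (Finset.univ.filter (fun a => a - g ∈ K))}

/-- A subgroup `K` is maximal for the channel `W` if `C^U_{|K*|} ≥ C^U_{|S*|}`
for every subgroup `S` of `K`. -/
def isMaximalForChannel {G Y : Type*} [AddCommGroup G] [Fintype G] [Fintype Y]
    (W : G → Y → ℝ) (K : AddSubgroup G) : Prop :=
  ∀ S : AddSubgroup G, (S : Set G) ⊆ (K : Set G) → maxCosetCU W S ≤ maxCosetCU W K


lemma aux_pt (p q t : ℝ) (hp : 0 ≤ p) (hq : 0 ≤ q) (hpq : 0 < p → 0 < q) (ht : 0 < t) :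
    p * Real.log t - p * Real.log (p / q) ≤ q * t - p := by
  rcases hp.eq_or_lt with h | h
  · subst h; simp; positivity
  · have hq' := hpq h
    have h1 : Real.log (q * t / p) ≤ q * t / p - 1 := Real.log_le_sub_one_of_pos (by positivity)
    have h2 : Real.log (q * t / p) = Real.log t - Real.log (p / q) := by
      rw [Real.log_div (by positivity) h.ne', Real.log_mul hq'.ne' ht.ne',
        Real.log_div h.ne' hq'.ne']
      ring
    rw [h2] at h1
    have h3 := mul_le_mul_of_nonneg_left h1 h.le
    have h4 : p * (q * t / p - 1) = q * t - p := by field_simp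
    linarith

lemma aux_sum_Wn {G Y : Type*} [Fintype Y] (W : G → Y → ℝ) (hW1 : ∀ x, ∑ y, W x y = 1)
    {n : ℕ} (x : Fin n → G) : ∑ y, Wn W x y = 1 := by
  unfold Wn
  rw [← Fintype.prod_sum (fun N y => W (x N) y)]
  simp [hW1]

lemma aux_marg {G Y : Type*} [Fintype Y] (W : G → Y → ℝ) (hW1 : ∀ x, ∑ y, W x y = 1)
    {n : ℕ} (x : Fin n → G) (N : Fin n) (h : Y → ℝ) :
    ∑ y, Wn W x y * h (y N) = ∑ b, W (x N) b * h b := by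
  unfold Wn
  have h1 : ∀ y : Fin n → Y, (∏ i, W (x i) (y i)) * h (y N)
      = ∏ i, (W (x i) (y i) * if i = N then h (y i) else 1) := by
    intro y
    rw [Finset.prod_mul_distrib]
    simp
  simp_rw [h1]
  rw [← Fintype.prod_sum (fun i b => W (x i) b * if i = N then h b else 1)]
  rw [Finset.prod_eq_single N]
  · simp
  · intro i _ hi
    simp [hi, hW1]
  · simp

lemma aux_fano {G Y : Type*} [Fintype G] [Fintype Y] (W : G → Y → ℝ)
    (hW0 : ∀ x y, 0 ≤ W x y) (hW1 : ∀ x, ∑ y, W x y = 1) {n M : ℕ} (hM : 0 < M)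
    (e : Fin M → Fin n → G) (f : (Fin n → Y) → Fin M)
    (Q : Fin n → Y → ℝ) (hQ0 : ∀ N y, 0 ≤ Q N y) (hQ1 : ∀ N, ∑ y, Q N y = 1)
    (hQ : ∀ m N y, 0 < W (e m N) y → 0 < Q N y) :
    Real.log M * (1 - avgErr W e f) ≤
      ∑ N, (M : ℝ)⁻¹ * ∑ m, ∑ y, W (e m N) y * Real.log (W (e m N) y / Q N y) + 1 := by
  have hMr : (0 : ℝ) < M := by exact_mod_cast hM
  let t : Fin M → (Fin n → Y) → ℝ := fun m y => if f y = m then (M : ℝ) else 1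
  let q : (Fin n → Y) → ℝ := fun y => ∏ N, Q N (y N)
  have hq0 : ∀ y, 0 ≤ q y := fun y => Finset.prod_nonneg fun N _ => hQ0 _ _
  have hq1 : ∑ y, q y = 1 := by
    simp only [q]
    rw [← Fintype.prod_sum (fun N y => Q N y)]
    simp [hQ1]
  have hp0 : ∀ m y, 0 ≤ Wn W (e m) y := fun m y => Finset.prod_nonneg fun N _ => hW0 _ _
  have hWpos : ∀ m y, 0 < Wn W (e m) y → ∀ N, 0 < W (e m N) (y N) := by
    intro m y h N
    refine lt_of_le_of_ne (hW0 _ _) fun h0 => h.ne' ?_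
    exact Finset.prod_eq_zero (Finset.mem_univ N) h0.symm
  have key : ∀ m y, Wn W (e m) y * Real.log (t m y)
      - Wn W (e m) y * Real.log (Wn W (e m) y / q y) ≤ q y * t m y - Wn W (e m) y := by
    intro m y
    apply aux_pt _ _ _ (hp0 m y) (hq0 y)
    · intro h
      exact Finset.prod_pos fun N _ => hQ m N _ (hWpos m y h N)
    · simp only [t]; split_ifs <;> positivity
  have hsum := Finset.sum_le_sum fun m (_ : m ∈ (Finset.univ : Finset (Fin M))) =>
    Finset.sum_le_sum fun y (_ : y ∈ (Finset.univ : Finset (Fin n → Y))) => key m y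
  simp only [Finset.sum_sub_distrib, aux_sum_Wn W hW1] at hsum
  have e1 : ∑ m, ∑ y, Wn W (e m) y * Real.log (t m y) = M * (Real.log M * (1 - avgErr W e f)) := by
    have : ∀ m y, Wn W (e m) y * Real.log (t m y) =
        Real.log M * (Wn W (e m) y - if f y ≠ m then Wn W (e m) y else 0) := by
      intro m y
      by_cases h : f y = m <;> simp [t, h, mul_comm]
    simp_rw [this, ← Finset.mul_sum, Finset.sum_sub_distrib, aux_sum_Wn W hW1]
    unfold avgErr
    simp only [Finset.sum_const, Finset.card_univ, Fintype.card_fin, nsmul_eq_mul, mul_one]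
    field_simp
  have e2 : ∑ m, ∑ y, q y * t m y ≤ 2 * M := by
    rw [Finset.sum_comm]
    have : ∀ y, ∑ m, q y * t m y ≤ q y * (2 * M) := by
      intro y
      rw [← Finset.mul_sum]
      refine mul_le_mul_of_nonneg_left ?_ (hq0 y)
      have : ∀ m, t m y ≤ (if f y = m then (M : ℝ) else 0) + 1 := by
        intro m; simp only [t]; split_ifs <;> simp
      refine (Finset.sum_le_sum fun m _ => this m).trans ?_
      rw [Finset.sum_add_distrib]
      simp
      linarith
    refine (Finset.sum_le_sum fun y _ => this y).trans ?_
    rw [← Finset.sum_mul, hq1, one_mul]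
  have e3 : ∑ m, ∑ y, Wn W (e m) y * Real.log (Wn W (e m) y / q y) =
      ∑ N, ∑ m, ∑ y, W (e m N) y * Real.log (W (e m N) y / Q N y) := by
    rw [Finset.sum_comm (s := (Finset.univ : Finset (Fin n)))]
    refine Finset.sum_congr rfl fun m _ => ?_
    have : ∀ y, Wn W (e m) y * Real.log (Wn W (e m) y / q y) =
        ∑ N, Wn W (e m) y * Real.log (W (e m N) (y N) / Q N (y N)) := by
      intro y
      rcases (hp0 m y).eq_or_lt with h | h
      · simp [← h]
      · rw [← Finset.mul_sum]
        congr 1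
        rw [← Real.log_prod]
        · simp only [q, Wn, Finset.prod_div_distrib]
        · intro N _
          have h1 := hWpos m y h N
          have h2 := hQ m N _ h1
          positivity
    simp_rw [this]
    rw [Finset.sum_comm]
    refine Finset.sum_congr rfl fun N _ => ?_
    exact aux_marg W hW1 (e m) N (fun b => Real.log (W (e m N) b / Q N b))
  rw [e1, e3] at hsum
  simp only [Finset.sum_const, Finset.card_univ, Fintype.card_fin, nsmul_eq_mul, mul_one] at hsum
  rw [← Finset.mul_sum]
  have : (M : ℝ) * (Real.log M * (1 - avgErr W e f)) ≤
    M * ((M : ℝ)⁻¹ * ∑ N, ∑ m, ∑ y, W (e m N) y * Real.log (W (e m N) y / Q N y) + 1) := by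
    rw [mul_add, mul_inv_cancel_left₀ hMr.ne']
    linarith
  exact le_of_mul_le_mul_left this hMr

lemma aux_count {G : Type*} [AddCommGroup G] [Fintype G] {n M : ℕ} (hM : 0 < M)
    (C : AddSubgroup (Fin n → G)) (v : Fin n → G) (e : Fin M → Fin n → G)
    (he : ∀ m, e m ∈ {x | ∃ c ∈ C, x = c + v})
    (hu : ∀ x ∈ {x : Fin n → G | ∃ c ∈ C, x = c + v},
        Nat.card {m : Fin M // e m = x} * Nat.card C = M) (N : Fin n) (S : Finset G)
    (hS : S = Finset.univ.filter
      (fun a => a - v N ∈ C.map (Pi.evalAddMonoidHom (fun _ : Fin n => G) N))) (x : G) :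
    (M : ℝ)⁻¹ * ((Finset.univ.filter (fun m => e m N = x)).card : ℝ) =
      if x ∈ S then (S.card : ℝ)⁻¹ else 0 := by
  let a : G → ℕ := fun x => (Finset.univ.filter (fun m => e m N = x)).card
  let b : G → ℕ := fun x => ∑ c : C, if c.1 N + v N = x then 1 else 0
  have hCpos : 0 < Nat.card C := Nat.card_pos
  have hab : ∀ x, a x * Nat.card C = M * b x := by
    intro x
    have h1 : a x = ∑ c : C, if c.1 N + v N = x then Nat.card {m : Fin M // e m = c.1 + v} else 0 := by
      have h2 : ∀ c : C, (if c.1 N + v N = x then Nat.card {m : Fin M // e m = c.1 + v} else 0) =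
          ∑ m : Fin M, if e m = c.1 + v then (if e m N = x then 1 else 0) else 0 := by
        intro c
        rw [Nat.card_eq_fintype_card, Fintype.card_subtype, Finset.card_filter]
        split_ifs with h
        · refine Finset.sum_congr rfl fun m _ => ?_
          by_cases hm : e m = c.1 + v
          · simp [hm, h]
          · simp [hm]
        · symm
          refine Finset.sum_eq_zero fun m _ => ?_
          by_cases hm : e m = c.1 + v
          · simp [hm, h]
          · simp [hm]
      simp_rw [h2]
      rw [Finset.sum_comm]
      simp only [a]
      rw [Finset.card_filter]
      refine Finset.sum_congr rfl fun m _ => ?_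
      obtain ⟨c, hc, hcm⟩ := he m
      rw [Finset.sum_eq_single (⟨c, hc⟩ : C)]
      · simp [hcm]
      · intro c' _ hne
        rw [if_neg]
        intro h
        apply hne
        ext1
        rw [hcm] at h
        exact (add_right_cancel h).symm
      · simp
    rw [h1, Finset.sum_mul, Finset.mul_sum]
    refine Finset.sum_congr rfl fun c _ => ?_
    split_ifs
    · rw [hu _ ⟨c.1, c.2, rfl⟩]; simp
    · simp
  have hb : ∀ (d : C) x, b (x + d.1 N) = b x := by
    intro d x
    simp only [b]
    rw [← Equiv.sum_comp (Equiv.addRight d)]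
    refine Finset.sum_congr rfl fun c _ => ?_
    congr 1
    simp only [Equiv.coe_addRight, AddSubgroup.coe_add, Pi.add_apply, eq_iff_iff]
    rw [add_right_comm]
    exact add_left_inj _
  have ha : ∀ (d : C) x, a (x + d.1 N) = a x := by
    intro d x
    apply Nat.eq_of_mul_eq_mul_right hCpos
    rw [hab, hab, hb]
  have hin : ∀ x ∈ S, a x = a (v N) := by
    intro x hx
    rw [hS] at hx
    simp only [Finset.mem_filter, Finset.mem_univ, true_and] at hx
    obtain ⟨d, hd, hdx⟩ := hx
    have := ha ⟨d, hd⟩ (v N)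
    have h3 : v N + d N = x := by
      have : d N = x - v N := hdx
      rw [this]; abel
    rw [← this, h3]
  have hout : ∀ x, x ∉ S → a x = 0 := by
    intro x hx
    simp only [a, Finset.card_eq_zero, Finset.filter_eq_empty_iff]
    intro m _ hm
    apply hx
    rw [hS]
    simp only [Finset.mem_filter, Finset.mem_univ, true_and]
    obtain ⟨c, hc, hcm⟩ := he m
    exact ⟨c, hc, by rw [← hm, hcm]; simp⟩
  have htot : ∑ x, a x = M := by
    have := Finset.card_eq_sum_card_fiberwise (s := (Finset.univ : Finset (Fin M)))
      (t := (Finset.univ : Finset G)) (f := fun m => e m N) (fun _ _ => by simp)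
    simp only [Finset.card_univ, Fintype.card_fin] at this
    exact this.symm
  have hSM : S.card * a (v N) = M := by
    rw [← htot, ← Finset.sum_subset (Finset.subset_univ S) (fun x _ h => hout x h),
      Finset.sum_congr rfl hin]
    simp
  change (M : ℝ)⁻¹ * (a x : ℝ) = _
  split_ifs with h
  · rw [hin x h]
    have h1 : (S.card : ℝ) * a (v N) = M := by exact_mod_cast hSM
    have h2 : (M : ℝ) ≠ 0 := by exact_mod_cast hM.ne'
    rw [← h1] at h2 ⊢
    have h3 := left_ne_zero_of_mul h2
    have h4 := right_ne_zero_of_mul h2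
    field_simp
  · simp [hout x h]

lemma aux_bdd {G Y : Type*} [AddCommGroup G] [Fintype G] [Fintype Y]
    (W : G → Y → ℝ) (K : AddSubgroup G) (g : G) :
    CU W (Finset.univ.filter (fun a => a - g ∈ K)) ≤ maxCosetCU W K := by
  apply le_csSup
  · apply Set.Finite.bddAbove
    refine (Set.finite_range (fun g : G => CU W (Finset.univ.filter (fun a => a - g ∈ K)))).subset ?_
    rintro x ⟨g, rfl⟩
    exact ⟨g, rfl⟩
  · exact ⟨g, rfl⟩

lemma aux_MI {G Y : Type*} [Fintype G] [Fintype Y] (W : G → Y → ℝ) (P : G → ℝ) :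
    mutualInfo W P * Real.log 2 =
      ∑ x, P x * ∑ y, W x y * Real.log (W x y / ∑ x', P x' * W x' y) := by
  unfold mutualInfo
  rw [Finset.sum_mul]
  refine Finset.sum_congr rfl fun x _ => ?_
  rw [Finset.sum_mul, Finset.mul_sum]
  refine Finset.sum_congr rfl fun y _ => ?_
  by_cases h : P x = 0
  · simp [h]
  · rw [mul_div_mul_left _ _ h, Real.logb]
    have : Real.log 2 ≠ 0 := (Real.log_pos (by norm_num)).ne'
    field_simp

lemma aux_main {G Y : Type*} [AddCommGroup G] [Fintype G] [Fintype Y]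
    (W : G → Y → ℝ) (hW0 : ∀ x y, 0 ≤ W x y) (hW1 : ∀ x, ∑ y, W x y = 1)
    (H : AddSubgroup G) (hmax : isMaximalForChannel W H) {n M : ℕ} (hM : 0 < M)
    (C : AddSubgroup (Fin n → G)) (v : Fin n → G) (e : Fin M → Fin n → G)
    (f : (Fin n → Y) → Fin M)
    (hC : ∀ c ∈ C, ∀ N, c N ∈ (H : Set G))
    (he : ∀ m, e m ∈ {x | ∃ c ∈ C, x = c + v})
    (hu : ∀ x ∈ {x : Fin n → G | ∃ c ∈ C, x = c + v},
        Nat.card {m : Fin M // e m = x} * Nat.card C = M) :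
    Real.log M * (1 - avgErr W e f) ≤ n * (maxCosetCU W H * Real.log 2) + 1 := by
  have hMr : (0 : ℝ) < M := by exact_mod_cast hM
  let P : Fin n → G → ℝ := fun N x => (M : ℝ)⁻¹ * ((Finset.univ.filter (fun m => e m N = x)).card : ℝ)
  have hP0 : ∀ N x, 0 ≤ P N x := fun N x => by simp only [P]; positivity
  have hPF : ∀ N (F : G → ℝ), (M : ℝ)⁻¹ * ∑ m, F (e m N) = ∑ x, P N x * F x := by
    intro N F
    rw [← Finset.sum_fiberwise (s := (Finset.univ : Finset (Fin M))) (g := fun m => e m N),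
      Finset.mul_sum]
    refine Finset.sum_congr rfl fun x _ => ?_
    simp only [P]
    rw [mul_assoc]
    congr 1
    rw [Finset.sum_congr rfl (g := fun _ => F x)]
    · simp
    · intro m hm
      simp only [Finset.mem_filter] at hm
      rw [hm.2]
  have hP1 : ∀ N, ∑ x, P N x = 1 := by
    intro N
    have := hPF N (fun _ => 1)
    simp at this
    rw [← this]
    field_simp
  let Q : Fin n → Y → ℝ := fun N y => ∑ x, P N x * W x y
  have hPe : ∀ m N, 0 < P N (e m N) := by
    intro m N
    have : 0 < (Finset.univ.filter (fun m' => e m' N = e m N)).card :=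
      Finset.card_pos.2 ⟨m, by simp⟩
    simp only [P]
    positivity
  have := aux_fano W hW0 hW1 hM e f Q
    (fun N y => Finset.sum_nonneg fun x _ => mul_nonneg (hP0 _ _) (hW0 _ _))
    (fun N => by
      simp only [Q]
      rw [Finset.sum_comm]
      simp_rw [← Finset.mul_sum, hW1, mul_one, hP1])
    (fun m N y h => Finset.sum_pos' (fun x _ => mul_nonneg (hP0 _ _) (hW0 _ _))
      ⟨e m N, Finset.mem_univ _, mul_pos (hPe m N) h⟩)
  refine this.trans ?_
  gcongr
  have hN : ∀ N : Fin n, (M : ℝ)⁻¹ * ∑ m, ∑ y, W (e m N) y * Real.log (W (e m N) y / Q N y) ≤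
      maxCosetCU W H * Real.log 2 := by
    intro N
    rw [hPF N (fun x => ∑ y, W x y * Real.log (W x y / Q N y))]
    simp only [Q]
    rw [← aux_MI]
    refine mul_le_mul_of_nonneg_right ?_ (Real.log_pos (by norm_num)).le
    have h1 := aux_bdd W (C.map (Pi.evalAddMonoidHom (fun _ : Fin n => G) N)) (v N)
    have h2 := hmax (C.map (Pi.evalAddMonoidHom (fun _ : Fin n => G) N)) (by
      rintro _ ⟨c, hc, rfl⟩
      exact hC c hc N)
    refine le_trans (le_of_eq ?_) (h1.trans h2)
    unfold CU
    congr 1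
    funext x
    exact aux_count hM C v e he hu N _ rfl x
  refine (Finset.sum_le_sum fun N _ => hN N).trans ?_
  simp

lemma aux_nonneg {G Y : Type*} [AddCommGroup G] [Fintype G] [Fintype Y]
    (W : G → Y → ℝ) (H : AddSubgroup G) (hmax : isMaximalForChannel W H) :
    0 ≤ maxCosetCU W H := by
  have h1 := aux_bdd W ⊥ (0 : G)
  have h2 := hmax ⊥ (by simp)
  refine le_trans (le_of_eq ?_) (h1.trans h2)
  unfold CU mutualInfo
  symm
  refine Finset.sum_eq_zero fun x _ => Finset.sum_eq_zero fun y _ => ?_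
  by_cases h : x = 0
  · subst h
    by_cases hw : W 0 y = 0
    · simp [hw]
    · have hc : (Finset.univ.filter (fun x : G => x = 0)).card = 1 := by
        rw [Finset.card_eq_one]
        exact ⟨0, by ext; simp⟩
      simp [hw, hc]
  · simp [h]


/-- **Converse bound for maximal subchannels** (Lemma 3.8).
Let `(G, Y, W)` be a DMC with finite abelian input group `G` and let `H ≤ G` be maximal
for the channel. Then `C_{H,G}`, the supremum of rates achievable using shifted group
codes `ℂ + v` with `ℂ ≤ Hⁿ` and `v ∈ Gⁿ`, satisfies `C_{H,G} ≤ C^U_{|H*|}` where `H*`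
is an optimal coset of `H`. -/
theorem capacity_of_maximal_subchannel_le
    {G Y : Type*} [AddCommGroup G] [Fintype G] [Fintype Y]
    (W : G → Y → ℝ) (hW0 : ∀ x y, 0 ≤ W x y) (hW1 : ∀ x, ∑ y, W x y = 1)
    (H : AddSubgroup G) (hmax : isMaximalForChannel W H) :
    capacity W (H : Set G) ≤ maxCosetCU W H := by
  have hC0 := aux_nonneg W H hmax
  refine Real.sSup_le ?_ hC0
  rintro R ⟨hR0, hR⟩
  set K := maxCosetCU W H
  have hl2 : 0 < Real.log 2 := Real.log_pos (by norm_num)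
  have main : ∀ ε : ℝ, 0 < ε → ε < 1 → R ≤ K + ε * (2 + R) := by
    intro ε h0 h1
    obtain ⟨n₀, hn₀⟩ := hR ε h0
    obtain ⟨k, hk⟩ := exists_nat_gt (1 / (ε * Real.log 2))
    obtain ⟨n, hn0, hnk'⟩ : ∃ n, n₀ ≤ n ∧ k + 1 ≤ n :=
      ⟨max n₀ (k + 1), le_max_left _ _, le_max_right _ _⟩
    obtain ⟨M, C, v, e, f, hM, hC, he, hu, herr⟩ := hn₀ n hn0
    have hnk : (k : ℝ) + 1 ≤ n := by exact_mod_cast hnk'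
    have hMr : (0 : ℝ) < M := lt_of_lt_of_le (by positivity) hM
    have hMp : 0 < M := by exact_mod_cast hMr
    have hF := aux_main W hW0 hW1 H hmax hMp C v e f hC he hu
    have hlM : (n : ℝ) * (R - ε) * Real.log 2 ≤ Real.log M := by
      rw [← Real.log_rpow (by norm_num)]
      exact Real.log_le_log (by positivity) hM
    have hlM0 : 0 ≤ Real.log M := Real.log_natCast_nonneg M
    have hn1 : 1 ≤ n * (ε * Real.log 2) := by
      rw [div_lt_iff₀ (by positivity)] at hk
      have : (k : ℝ) * (ε * Real.log 2) ≤ n * (ε * Real.log 2) := by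
        apply mul_le_mul_of_nonneg_right (by linarith) (by positivity)
      linarith
    have hA : Real.log M * (1 - ε) ≤ Real.log M * (1 - avgErr W e f) :=
      mul_le_mul_of_nonneg_left (by linarith) hlM0
    have hB := mul_le_mul_of_nonneg_right hlM (by linarith : 0 ≤ 1 - ε)
    have hnpos : 0 < (n : ℝ) * Real.log 2 := mul_pos (by linarith [Nat.cast_nonneg (α := ℝ) k]) hl2
    have hD : ((n : ℝ) * Real.log 2) * ((R - ε) * (1 - ε)) ≤ ((n : ℝ) * Real.log 2) * (K + ε) := by
      change _ ≤ n * (K * Real.log 2) + 1 at hF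
      linarith
    have hE := le_of_mul_le_mul_left hD hnpos
    nlinarith
  by_contra! hlt
  have hpos : 0 < R - K := by linarith
  have h2R : 0 < 2 + R := by linarith
  have := main (min (1/2) ((R - K) / (2 * (2 + R)))) (by positivity)
    (lt_of_le_of_lt (min_le_left _ _) (by norm_num))
  have h3 : min (1/2) ((R - K) / (2 * (2 + R))) * (2 + R) ≤ (R - K) / (2 * (2 + R)) * (2 + R) :=
    mul_le_mul_of_nonneg_right (min_le_right _ _) h2R.le
  have h4 : (R - K) / (2 * (2 + R)) * (2 + R) = (R - K) / 2 := by field_simp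
  linarith

end
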